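/- Assume m ≥ 4. Then for all indices h, i, j, k the T-tensor T^{hijk} := K·C^{hij}|^k + a^h C^{ijk} + a^i C^{jkh} + a^j C^{khi} + a^k C^{hij}, where C^{hij}|^k = ∂C^{hij}/∂p_k + ∑_r (C^{rij}C_r^{hk} + C^{hrj}C_r^{ik} + C^{hir}C_r^{jk}), satisfies T^{hijk} = −((m−1)(m−2)(m−3)/(2K))·a^{hijk} + ((m−1)(m−2)²/(4K))·∑_r (a_r^{hk}a^{rij} + a_r^{ik}a^{rhj} + a_r^{jk}a^{rhi}) − (m(m−1)(m−2)/(4K))·(a^{hij}a^k + a^{hjk}a^i + a^{ijk}a^h + a^{hik}a^j − a^{ij}a^{hk} − a^{hj}a^{ik} − a^{ih}a^{jk}). -/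

import Mathlib

open Finset

noncomputable section

/-- `A(p) = ∑ a^{i₁…i_m} p_{i₁}⋯p_{i_m}`, where `m = M + 4 ≥ 4`. -/
def Afun {n M : ℕ} (a : (Fin (M + 4) → Fin n) → ℝ) (p : Fin n → ℝ) : ℝ :=
  ∑ ι : Fin (M + 4) → Fin n, a ι * ∏ t, p (ι t)

/-- `K(p) = A(p)^{1/m}`. -/
def Kfun {n M : ℕ} (a : (Fin (M + 4) → Fin n) → ℝ) (p : Fin n → ℝ) : ℝ :=
  Afun a p ^ ((1 : ℝ) / (M + 4))

/-- `a^i = (∑ a^{i i₂…i_m} p_{i₂}⋯p_{i_m}) / K^{m-1}`. -/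
def aU1 {n M : ℕ} (a : (Fin (M + 4) → Fin n) → ℝ) (i : Fin n) (p : Fin n → ℝ) : ℝ :=
  (∑ ι : Fin (M + 3) → Fin n, a (Fin.cons i ι) * ∏ t, p (ι t)) / Kfun a p ^ (M + 3)

/-- `a^{ij} = (∑ a^{i j i₃…i_m} p_{i₃}⋯p_{i_m}) / K^{m-2}`. -/
def aU2 {n M : ℕ} (a : (Fin (M + 4) → Fin n) → ℝ) (i j : Fin n) (p : Fin n → ℝ) : ℝ :=
  (∑ ι : Fin (M + 2) → Fin n, a (Fin.cons i (Fin.cons j ι)) * ∏ t, p (ι t)) / Kfun a p ^ (M + 2)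

/-- `a^{ijk} = (∑ a^{i j k i₄…i_m} p_{i₄}⋯p_{i_m}) / K^{m-3}`. -/
def aU3 {n M : ℕ} (a : (Fin (M + 4) → Fin n) → ℝ) (i j k : Fin n) (p : Fin n → ℝ) : ℝ :=
  (∑ ι : Fin (M + 1) → Fin n, a (Fin.cons i (Fin.cons j (Fin.cons k ι))) * ∏ t, p (ι t)) /
    Kfun a p ^ (M + 1)

/-- `a^{hijk} = (∑ a^{h i j k i₅…i_m} p_{i₅}⋯p_{i_m}) / K^{m-4}`. -/
def aU4 {n M : ℕ} (a : (Fin (M + 4) → Fin n) → ℝ) (h i j k : Fin n) (p : Fin n → ℝ) : ℝ :=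
  (∑ ι : Fin M → Fin n, a (Fin.cons h (Fin.cons i (Fin.cons j (Fin.cons k ι)))) * ∏ t, p (ι t)) /
    Kfun a p ^ M

/-- Partial derivative `∂f/∂p_k` of a function of `p`. -/
def pd {n : ℕ} (f : (Fin n → ℝ) → ℝ) (k : Fin n) (p : Fin n → ℝ) : ℝ :=
  deriv (fun t => f (Function.update p k t)) (p k)

/-- Fundamental metrical d-tensor `g^{ij} = (1/2) ∂²(K²)/∂p_i∂p_j`. -/
def gU {n M : ℕ} (a : (Fin (M + 4) → Fin n) → ℝ) (i j : Fin n) (p : Fin n → ℝ) : ℝ :=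
  (1 / 2 : ℝ) * pd (fun q => pd (fun r => Kfun a r ^ 2) j q) i p

/-- Angular metrical d-tensor `h^{ij} = K ∂²K/∂p_i∂p_j`. -/
def hU {n M : ℕ} (a : (Fin (M + 4) → Fin n) → ℝ) (i j : Fin n) (p : Fin n → ℝ) : ℝ :=
  Kfun a p * pd (fun q => pd (Kfun a) j q) i p

/-- v-torsion d-tensor `C^{ijk} = -(1/2) ∂g^{ij}/∂p_k`. -/
def CU {n M : ℕ} (a : (Fin (M + 4) → Fin n) → ℝ) (i j k : Fin n) (p : Fin n → ℝ) : ℝ :=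
  -(1 / 2 : ℝ) * pd (gU a i j) k p

/-- Symmetry of `a` in all of its `m` indices. -/
def aSym {n M : ℕ} (a : (Fin (M + 4) → Fin n) → ℝ) : Prop :=
  ∀ (σ : Equiv.Perm (Fin (M + 4))) (ι : Fin (M + 4) → Fin n), a (ι ∘ σ) = a ι

/-- `a_i = ∑_s a_{is} a^s`, where `aLow` is the inverse matrix of `(a^{ij})`. -/
def aL {n M : ℕ} (a : (Fin (M + 4) → Fin n) → ℝ) (aLow : Matrix (Fin n) (Fin n) ℝ)
    (p : Fin n → ℝ) (i : Fin n) : ℝ :=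
  ∑ s, aLow i s * aU1 a s p

/-- `a_i^{jk} = ∑_s a_{is} a^{sjk}`. -/
def aL3 {n M : ℕ} (a : (Fin (M + 4) → Fin n) → ℝ) (aLow : Matrix (Fin n) (Fin n) ℝ)
    (p : Fin n → ℝ) (i j k : Fin n) : ℝ :=
  ∑ s, aLow i s * aU3 a s j k p

/-- `g_{ij} = (1/(m-1)) a_{ij} + ((m-2)/(m-1)) a_i a_j`, the inverse of `g^{ij}`. -/
def gL {n M : ℕ} (a : (Fin (M + 4) → Fin n) → ℝ) (aLow : Matrix (Fin n) (Fin n) ℝ)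
    (p : Fin n → ℝ) (i j : Fin n) : ℝ :=
  (1 / (M + 3 : ℝ)) * aLow i j + ((M + 2 : ℝ) / (M + 3)) * aL a aLow p i * aL a aLow p j

/-- v-derivation components `C_i^{jk} = ∑_s g_{is} C^{sjk}`. -/
def CL {n M : ℕ} (a : (Fin (M + 4) → Fin n) → ℝ) (aLow : Matrix (Fin n) (Fin n) ℝ)
    (p : Fin n → ℝ) (i j k : Fin n) : ℝ :=
  ∑ s, gL a aLow p i s * CU a s j k p

/-- homogeneous form attached to a coefficient family -/
def PP {n : ℕ} {d : ℕ} (b : (Fin d → Fin n) → ℝ) (p : Fin n → ℝ) : ℝ :=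
  ∑ ι : Fin d → Fin n, b ι * ∏ t, p (ι t)

/-- symmetry in all indices -/
def SymF {n : ℕ} {d : ℕ} (b : (Fin d → Fin n) → ℝ) : Prop :=
  ∀ (σ : Equiv.Perm (Fin d)) (ι : Fin d → Fin n), b (ι ∘ σ) = b ι

lemma SymF.cons {n d : ℕ} {b : (Fin (d + 1) → Fin n) → ℝ} (hb : SymF b) (i : Fin n) :
    SymF (fun ι => b (Fin.cons i ι)) := by
  intro σ ι
  have := hb (Equiv.Perm.decomposeFin.symm (0, σ)) (Fin.cons i ι)
  simp only
  rw [← this]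
  congr 1
  funext x
  refine Fin.cases ?_ (fun y => ?_) x
  · simp
  · simp

lemma SymF.swap {n d : ℕ} {b : (Fin (d + 2) → Fin n) → ℝ} (hb : SymF b) (i j : Fin n)
    (ι : Fin d → Fin n) :
    b (Fin.cons i (Fin.cons j ι)) = b (Fin.cons j (Fin.cons i ι)) := by
  rw [← hb (Equiv.swap 0 1) (Fin.cons j (Fin.cons i ι))]
  congr 1
  funext x
  refine Fin.cases ?_ (fun y => ?_) x
  · simp only [Function.comp, Equiv.swap_apply_left]
    rfl
  · refine Fin.cases ?_ (fun z => ?_) y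
    · simp only [Function.comp]
      rw [show (Fin.succ (0 : Fin (d + 1))) = 1 from rfl, Equiv.swap_apply_right]
      rfl
    · simp only [Function.comp]
      rw [Equiv.swap_apply_of_ne_of_ne (Fin.succ_ne_zero _)]
      · simp
      · rw [show (1 : Fin (d + 2)) = Fin.succ (0 : Fin (d + 1)) from rfl]
        intro h
        exact Fin.succ_ne_zero _ (Fin.succ_injective _ h)

lemma PP_succ {n d : ℕ} (b : (Fin (d + 1) → Fin n) → ℝ) (p : Fin n → ℝ) :
    PP b p = ∑ i, p i * PP (fun ι => b (Fin.cons i ι)) p := by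
  unfold PP
  rw [← Equiv.sum_comp (Fin.consEquiv (fun _ : Fin (d + 1) => Fin n)), Fintype.sum_prod_type]
  refine Finset.sum_congr rfl fun i _ => ?_
  rw [Finset.mul_sum]
  refine Finset.sum_congr rfl fun ι _ => ?_
  simp only [Fin.consEquiv, Equiv.coe_fn_mk, Fin.prod_univ_succ, Fin.cons_zero, Fin.cons_succ]
  ring

/-- `f` has partial derivative `f'` -/
def HasPd {n : ℕ} (f : (Fin n → ℝ) → ℝ) (f' : ℝ) (k : Fin n) (p : Fin n → ℝ) : Prop :=
  HasDerivAt (fun t => f (Function.update p k t)) f' (p k)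

lemma HasPd.pd_eq {n : ℕ} {f : (Fin n → ℝ) → ℝ} {f' : ℝ} {k : Fin n} {p : Fin n → ℝ}
    (h : HasPd f f' k p) : pd f k p = f' := HasDerivAt.deriv h

lemma hasPd_coord {n : ℕ} (i k : Fin n) (p : Fin n → ℝ) :
    HasPd (fun q => q i) (if i = k then 1 else 0) k p := by
  unfold HasPd
  by_cases h : i = k
  · subst h
    simpa using hasDerivAt_id' (p i)
  · simpa [h] using hasDerivAt_const (p k) (p i)

lemma HasPd.mul {n : ℕ} {f g : (Fin n → ℝ) → ℝ} {f' g' : ℝ} {k : Fin n} {p : Fin n → ℝ}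
    (hf : HasPd f f' k p) (hg : HasPd g g' k p) :
    HasPd (fun q => f q * g q) (f' * g p + f p * g') k p := by
  have := HasDerivAt.fun_mul hf hg
  simpa [HasPd, Function.update_eq_self] using this

lemma HasPd.sub {n : ℕ} {f g : (Fin n → ℝ) → ℝ} {f' g' : ℝ} {k : Fin n} {p : Fin n → ℝ}
    (hf : HasPd f f' k p) (hg : HasPd g g' k p) :
    HasPd (fun q => f q - g q) (f' - g') k p := HasDerivAt.sub hf hg

lemma HasPd.add {n : ℕ} {f g : (Fin n → ℝ) → ℝ} {f' g' : ℝ} {k : Fin n} {p : Fin n → ℝ}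
    (hf : HasPd f f' k p) (hg : HasPd g g' k p) :
    HasPd (fun q => f q + g q) (f' + g') k p := HasDerivAt.add hf hg

lemma HasPd.const_mul {n : ℕ} {f : (Fin n → ℝ) → ℝ} {f' : ℝ} {k : Fin n} {p : Fin n → ℝ}
    (c : ℝ) (hf : HasPd f f' k p) :
    HasPd (fun q => c * f q) (c * f') k p := HasDerivAt.const_mul c hf

lemma HasPd.congr' {n : ℕ} {f : (Fin n → ℝ) → ℝ} {f' g' : ℝ} {k : Fin n} {p : Fin n → ℝ}
    (hf : HasPd f f' k p) (h : f' = g') : HasPd f g' k p := h ▸ hf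

lemma HasPd.div_pow {n : ℕ} {f g : (Fin n → ℝ) → ℝ} {f' g' : ℝ} {k : Fin n} {p : Fin n → ℝ}
    (hf : HasPd f f' k p) (hg : HasPd g g' k p) (hp : g p ≠ 0) (d : ℕ) :
    HasPd (fun q => f q / g q ^ d) (f' / g p ^ d - d * f p * g' / g p ^ (d + 1)) k p := by
  have h1 := HasDerivAt.fun_pow hg d
  have h2 := HasDerivAt.fun_div hf h1 (by simpa [Function.update_eq_self] using pow_ne_zero d hp)
  unfold HasPd
  refine h2.congr_deriv ?_
  simp only [Function.update_eq_self]
  symm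
  cases d with
  | zero => simp
  | succ d => 
    simp only [Nat.add_sub_cancel]
    field_simp
    ring

lemma hasPd_PP {n d : ℕ} (b : (Fin (d + 1) → Fin n) → ℝ) (hb : SymF b) (k : Fin n)
    (p : Fin n → ℝ) :
    HasPd (PP b) ((d + 1 : ℝ) * PP (fun ι => b (Fin.cons k ι)) p) k p := by
  have key : ∀ F' : Fin n → ℝ, (∀ i, HasPd (PP (fun ι => b (Fin.cons i ι))) (F' i) k p) →
      HasPd (PP b) (PP (fun ι => b (Fin.cons k ι)) p + ∑ i, p i * F' i) k p := by
    intro F' hF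
    have h1 : HasPd (fun q => ∑ i, q i * PP (fun ι => b (Fin.cons i ι)) q)
        (∑ i, ((if i = k then 1 else 0) * PP (fun ι => b (Fin.cons i ι)) p + p i * F' i)) k p := by
      unfold HasPd
      exact HasDerivAt.fun_sum (fun i _ => (hasPd_coord i k p).mul (hF i))
    have h2 : PP b = fun q => ∑ i, q i * PP (fun ι => b (Fin.cons i ι)) q := by
      funext q; exact PP_succ b q
    rw [h2]
    refine h1.congr' ?_
    rw [Finset.sum_add_distrib]
    simp
  induction d with
  | zero =>
    refine (key (fun _ => 0) ?_).congr' ?_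
    · intro i
      unfold HasPd PP
      simpa using hasDerivAt_const (p k) _
    · simp
  | succ d ih =>
    have hh := fun i => ih (fun ι => b (Fin.cons i ι)) (hb.cons i) (by
      intro F' hF
      have h1 : HasPd (fun q => ∑ j, q j * PP (fun ι => b (Fin.cons i (Fin.cons j ι))) q)
          (∑ j, ((if j = k then 1 else 0) * PP (fun ι => b (Fin.cons i (Fin.cons j ι))) p
            + p j * F' j)) k p := by
        unfold HasPd
        exact HasDerivAt.fun_sum (fun j _ => (hasPd_coord j k p).mul (hF j))
      have h2 : PP (fun ι => b (Fin.cons i ι)) =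
          fun q => ∑ j, q j * PP (fun ι => b (Fin.cons i (Fin.cons j ι))) q := by
        funext q; exact PP_succ _ q
      rw [h2]
      refine h1.congr' ?_
      rw [Finset.sum_add_distrib]
      simp)
    refine (key _ hh).congr' ?_
    rw [PP_succ (fun ι => b (Fin.cons k ι))]
    simp only [hb.swap _ k, Finset.mul_sum, ← Finset.sum_add_distrib]
    refine Finset.sum_congr rfl fun i _ => ?_
    push_cast
    ring

section main
variable {n M : ℕ} {a : (Fin (M + 4) → Fin n) → ℝ} {p : Fin n → ℝ}

lemma K_pos (hA : 0 < Afun a p) : 0 < Kfun a p := Real.rpow_pos_of_pos hA _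

lemma K_pow (hA : 0 < Afun a p) : Kfun a p ^ (M + 4) = Afun a p := by
  unfold Kfun
  rw [← Real.rpow_natCast, ← Real.rpow_mul hA.le]
  push_cast
  rw [one_div, inv_mul_cancel₀ (by positivity), Real.rpow_one]

lemma hasPd_A (hsym : aSym a) (k : Fin n) (p : Fin n → ℝ) :
    HasPd (Afun a) ((M + 4 : ℝ) * PP (fun ι => a (Fin.cons k ι)) p) k p := by
  refine (hasPd_PP a hsym k p).congr' ?_
  push_cast
  ring

lemma hasPd_K (hsym : aSym a) (hA : 0 < Afun a p) (k : Fin n) :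
    HasPd (Kfun a) (aU1 a k p) k p := by
  have h := HasDerivAt.rpow_const (p := (1 : ℝ) / (M + 4)) (hasPd_A hsym k p)
    (Or.inl (by simpa [Function.update_eq_self] using hA.ne'))
  refine HasPd.congr' (f := Kfun a) h ?_
  simp only [Function.update_eq_self]
  rw [Real.rpow_sub_one hA.ne']
  have hK := (K_pos hA).ne'
  change _ * (Kfun a p / _) = _
  rw [← K_pow hA]
  unfold aU1
  change _ = PP (fun ι => a (Fin.cons k ι)) p / _
  have : (M + 4 : ℝ) ≠ 0 := by positivity
  field_simp
  ring

lemma pd_congr (hsym : aSym a) (hA : 0 < Afun a p) {f g : (Fin n → ℝ) → ℝ} {k : Fin n} {g' : ℝ}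
    (hfg : ∀ q, 0 < Afun a q → f q = g q) (hg : HasPd g g' k p) : HasPd f g' k p := by
  have hc : ContinuousAt (fun t => Afun a (Function.update p k t)) (p k) :=
    HasDerivAt.continuousAt (hasPd_A hsym k p)
  have : ∀ᶠ t in nhds (p k), 0 < Afun a (Function.update p k t) :=
    hc.eventually_const_lt (by simpa [Function.update_eq_self] using hA)
  exact HasDerivAt.congr_of_eventuallyEq hg (this.mono fun t ht => hfg _ ht)

lemma hasPd_aU1 (hsym : aSym a) (hA : 0 < Afun a p) (i k : Fin n) :
    HasPd (aU1 a i) ((M + 3 : ℝ) / Kfun a p * (aU2 a i k p - aU1 a i p * aU1 a k p)) k p := by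
  have hK := (K_pos hA).ne'
  refine ((hasPd_PP _ (SymF.cons hsym i) k p).div_pow (hasPd_K hsym hA k) hK (M + 3)).congr' ?_
  rw [show aU2 a i k p = PP (fun ι => a (Fin.cons i (Fin.cons k ι))) p / Kfun a p ^ (M + 2) from rfl,
    show aU1 a i p = PP (fun ι => a (Fin.cons i ι)) p / Kfun a p ^ (M + 3) from rfl]
  generalize aU1 a k p = y
  push_cast
  field_simp
  ring

lemma hasPd_aU2 (hsym : aSym a) (hA : 0 < Afun a p) (i j k : Fin n) :
    HasPd (aU2 a i j) ((M + 2 : ℝ) / Kfun a p * (aU3 a i j k p - aU2 a i j p * aU1 a k p)) k p := by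
  have hK := (K_pos hA).ne'
  refine ((hasPd_PP _ ((SymF.cons hsym i).cons j) k p).div_pow
    (hasPd_K hsym hA k) hK (M + 2)).congr' ?_
  rw [show aU3 a i j k p =
      PP (fun ι => a (Fin.cons i (Fin.cons j (Fin.cons k ι)))) p / Kfun a p ^ (M + 1) from rfl,
    show aU2 a i j p = PP (fun ι => a (Fin.cons i (Fin.cons j ι))) p / Kfun a p ^ (M + 2) from rfl]
  generalize aU1 a k p = y
  push_cast
  field_simp
  ring

lemma hasPd_aU3 (hsym : aSym a) (hA : 0 < Afun a p) (h i j k : Fin n) :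
    HasPd (aU3 a h i j)
      ((M + 1 : ℝ) / Kfun a p * (aU4 a h i j k p - aU3 a h i j p * aU1 a k p)) k p := by
  have hK := (K_pos hA).ne'
  refine ((hasPd_PP _ (((SymF.cons hsym h).cons i).cons j) k p).div_pow
    (hasPd_K hsym hA k) hK (M + 1)).congr' ?_
  rw [show aU4 a h i j k p =
      PP (fun ι => a (Fin.cons h (Fin.cons i (Fin.cons j (Fin.cons k ι))))) p / Kfun a p ^ M from rfl,
    show aU3 a h i j p =
      PP (fun ι => a (Fin.cons h (Fin.cons i (Fin.cons j ι)))) p / Kfun a p ^ (M + 1) from rfl]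
  generalize aU1 a k p = y
  push_cast
  field_simp
  ring

lemma aU2_symm (hsym : aSym a) (i j : Fin n) : aU2 a i j p = aU2 a j i p := by
  unfold aU2
  simp only [SymF.swap hsym i j]

lemma aU3_symm1 (hsym : aSym a) (i j k : Fin n) : aU3 a i j k p = aU3 a j i k p := by
  unfold aU3
  simp only [SymF.swap hsym i j]

lemma aU3_symm2 (hsym : aSym a) (i j k : Fin n) : aU3 a i j k p = aU3 a i k j p := by
  unfold aU3
  simp only [SymF.swap (SymF.cons hsym i) j k]

lemma gU_eq (hsym : aSym a) (hA : 0 < Afun a p) (i j : Fin n) :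
    gU a i j p = (M + 3 : ℝ) * aU2 a i j p - (M + 2 : ℝ) * (aU1 a i p * aU1 a j p) := by
  have h1 : ∀ q, 0 < Afun a q →
      pd (fun r => Kfun a r ^ 2) j q = 2 * (Kfun a q * aU1 a j q) := by
    intro q hq
    have := ((hasPd_K hsym hq j).mul (hasPd_K hsym hq j)).pd_eq
    simp only [← pow_two] at this
    rw [this]
    ring
  have h2 := (pd_congr hsym hA h1
    (((hasPd_K hsym hA i).mul (hasPd_aU1 hsym hA j i)).const_mul 2)).pd_eq
  unfold gU
  rw [h2, aU2_symm hsym j i]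
  have hK := (K_pos hA).ne'
  field_simp
  ring

lemma CU_eq (hsym : aSym a) (hA : 0 < Afun a p) (i j k : Fin n) :
    CU a i j k p = -((M + 3 : ℝ) * (M + 2) / 2) * ((aU3 a i j k p - aU2 a i j p * aU1 a k p
      - aU2 a i k p * aU1 a j p - aU2 a j k p * aU1 a i p
      + 2 * aU1 a i p * aU1 a j p * aU1 a k p) / Kfun a p ^ 1) := by
  unfold CU
  rw [(pd_congr hsym hA (fun q hq => gU_eq hsym hq i j)
    (((hasPd_aU2 hsym hA i j k).const_mul _).sub
      (((hasPd_aU1 hsym hA i k).mul (hasPd_aU1 hsym hA j k)).const_mul _))).pd_eq]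
  have hK := (K_pos hA).ne'
  field_simp
  ring

lemma pd_CU (hsym : aSym a) (hA : 0 < Afun a p) (h i j k : Fin n) :
    pd (CU a h i j) k p = -((M + 3 : ℝ) * (M + 2) / (2 * Kfun a p ^ 2)) * (
      (M + 1) * aU4 a h i j k p
      - (M + 2) * (aU3 a h i j p * aU1 a k p + aU3 a h i k p * aU1 a j p
          + aU3 a h j k p * aU1 a i p + aU3 a i j k p * aU1 a h p)
      - (M + 3) * (aU2 a h i p * aU2 a j k p + aU2 a h j p * aU2 a i k p
          + aU2 a i j p * aU2 a h k p)
      + 2 * (M + 3) * (aU2 a h k p * aU1 a i p * aU1 a j p + aU2 a i k p * aU1 a h p * aU1 a j p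
          + aU2 a j k p * aU1 a h p * aU1 a i p)
      + 2 * (M + 3) * (aU2 a h i p * aU1 a j p * aU1 a k p
          + aU2 a h j p * aU1 a i p * aU1 a k p + aU2 a i j p * aU1 a h p * aU1 a k p)
      - 6 * (M + 3) * aU1 a h p * aU1 a i p * aU1 a j p * aU1 a k p
      - 2 * aU1 a h p * aU1 a i p * aU1 a j p * aU1 a k p
      + 0) := by
  have d3 := hasPd_aU3 hsym hA h i j k
  have d1 := hasPd_aU1 hsym hA h k
  have d1' := hasPd_aU1 hsym hA i k
  have d1'' := hasPd_aU1 hsym hA j k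
  have e1 := hasPd_aU2 hsym hA h i k
  have e2 := hasPd_aU2 hsym hA h j k
  have e3 := hasPd_aU2 hsym hA i j k
  have hK := (K_pos hA).ne'
  have D := ((((((d3.sub (e1.mul d1'')).sub (e2.mul d1')).sub (e3.mul d1)).add
    (((d1.const_mul 2).mul d1').mul d1'')).div_pow (hasPd_K hsym hA k) hK 1).const_mul
      (-((M + 3 : ℝ) * (M + 2) / 2)))
  rw [(pd_congr hsym hA (fun q hq => CU_eq hsym hq h i j) D).pd_eq]
  push_cast
  field_simp
  ring

lemma eu1 (hA : 0 < Afun a p) : ∑ r, p r / Kfun a p * aU1 a r p = 1 := by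
  have hK := (K_pos hA).ne'
  have h := PP_succ a p
  change Afun a p = _ at h
  rw [← K_pow hA] at h
  have h2 : ∀ r, p r / Kfun a p * aU1 a r p =
      p r * PP (fun ι => a (Fin.cons r ι)) p / Kfun a p ^ (M + 4) := by
    intro r
    rw [show aU1 a r p = PP (fun ι => a (Fin.cons r ι)) p / Kfun a p ^ (M + 3) from rfl]
    field_simp
    ring
  simp only [h2]
  rw [← Finset.sum_div, ← h, div_self (pow_ne_zero _ hK)]

lemma eu2 (hsym : aSym a) (hA : 0 < Afun a p) (j : Fin n) :
    ∑ r, p r / Kfun a p * aU2 a r j p = aU1 a j p := by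
  have hK := (K_pos hA).ne'
  rw [show aU1 a j p = PP (fun ι => a (Fin.cons j ι)) p / Kfun a p ^ (M + 3) from rfl,
    PP_succ, Finset.sum_div]
  refine Finset.sum_congr rfl fun r _ => ?_
  rw [aU2_symm hsym, show aU2 a j r p =
    PP (fun ι => a (Fin.cons j (Fin.cons r ι))) p / Kfun a p ^ (M + 2) from rfl]
  field_simp
  ring

lemma eu3 (hsym : aSym a) (hA : 0 < Afun a p) (j k : Fin n) :
    ∑ r, p r / Kfun a p * aU3 a r j k p = aU2 a j k p := by
  have hK := (K_pos hA).ne'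
  rw [show aU2 a j k p = PP (fun ι => a (Fin.cons j (Fin.cons k ι))) p / Kfun a p ^ (M + 2) from rfl,
    PP_succ, Finset.sum_div]
  refine Finset.sum_congr rfl fun r _ => ?_
  rw [aU3_symm1 hsym, aU3_symm2 hsym, show aU3 a j k r p =
    PP (fun ι => a (Fin.cons j (Fin.cons k (Fin.cons r ι)))) p / Kfun a p ^ (M + 1) from rfl]
  field_simp
  ring

variable {aLow : Matrix (Fin n) (Fin n) ℝ}

lemma low_up (hInv₂ : aLow * (Matrix.of fun i j => aU2 a i j p) = 1) (r h : Fin n) :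
    ∑ s, aLow r s * aU2 a s h p = if r = h then 1 else 0 := by
  have := congrFun (congrFun hInv₂ r) h
  simpa [Matrix.mul_apply, Matrix.one_apply] using this

lemma up_low (hInv₁ : (Matrix.of fun i j => aU2 a i j p) * aLow = 1) (r h : Fin n) :
    ∑ s, aU2 a r s p * aLow s h = if r = h then 1 else 0 := by
  have := congrFun (congrFun hInv₁ r) h
  simpa [Matrix.mul_apply, Matrix.one_apply] using this

lemma aL_eq (hsym : aSym a) (hA : 0 < Afun a p)
    (hInv₂ : aLow * (Matrix.of fun i j => aU2 a i j p) = 1) (r : Fin n) :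
    aL a aLow p r = p r / Kfun a p := by
  unfold aL
  simp only [← eu2 hsym hA, Finset.mul_sum]
  rw [Finset.sum_comm]
  have : ∀ t, ∑ s, aLow r s * (p t / Kfun a p * aU2 a t s p) =
      p t / Kfun a p * if r = t then 1 else 0 := by
    intro t
    rw [← low_up hInv₂ r t, Finset.mul_sum]
    refine Finset.sum_congr rfl fun s _ => ?_
    rw [aU2_symm hsym t s]
    ring
  simp [this]

lemma aL3_up2 (hsym : aSym a) (hInv₁ : (Matrix.of fun i j => aU2 a i j p) * aLow = 1)
    (i h k : Fin n) : ∑ r, aU2 a r i p * aL3 a aLow p r h k = aU3 a i h k p := by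
  unfold aL3
  simp only [Finset.mul_sum]
  rw [Finset.sum_comm]
  have : ∀ s, ∑ r, aU2 a r i p * (aLow r s * aU3 a s h k p) =
      (if i = s then 1 else 0) * aU3 a s h k p := by
    intro s
    rw [← up_low hInv₁ i s, Finset.sum_mul]
    refine Finset.sum_congr rfl fun r _ => ?_
    rw [aU2_symm hsym r i]
    ring
  simp [this]

lemma aL3_up1 (hsym : aSym a) (hA : 0 < Afun a p)
    (hInv₁ : (Matrix.of fun i j => aU2 a i j p) * aLow = 1)
    (h k : Fin n) : ∑ r, aU1 a r p * aL3 a aLow p r h k = aU2 a h k p := by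
  rw [← eu3 hsym hA]
  simp only [← aL3_up2 hsym hInv₁, ← eu2 hsym hA, Finset.mul_sum, Finset.sum_mul]
  rw [Finset.sum_comm]
  refine Finset.sum_congr rfl fun r _ => Finset.sum_congr rfl fun s _ => ?_
  rw [aU2_symm hsym r s]
  ring

lemma CL_eq (hsym : aSym a) (hA : 0 < Afun a p)
    (hInv₂ : aLow * (Matrix.of fun i j => aU2 a i j p) = 1) (r h k : Fin n) :
    CL a aLow p r h k = -((M + 2 : ℝ) / (2 * Kfun a p)) * (aL3 a aLow p r h k
      - (if r = h then 1 else 0) * aU1 a k p - (if r = k then 1 else 0) * aU1 a h p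
      - aU2 a h k p * (p r / Kfun a p) + 2 * (p r / Kfun a p) * aU1 a h p * aU1 a k p) := by
  have hK := (K_pos hA).ne'
  have h0 : ∑ s, p s / Kfun a p * CU a s h k p = 0 := by
    have : ∀ s, p s / Kfun a p * CU a s h k p =
      -((M + 3 : ℝ) * (M + 2) / (2 * Kfun a p)) * (p s / Kfun a p * aU3 a s h k p
       - p s / Kfun a p * aU2 a s h p * aU1 a k p - p s / Kfun a p * aU2 a s k p * aU1 a h p
       - p s / Kfun a p * aU1 a s p * aU2 a h k p
       + p s / Kfun a p * aU1 a s p * (2 * aU1 a h p * aU1 a k p)) := by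
      intro s
      rw [CU_eq hsym hA]
      field_simp
    simp only [this, ← Finset.mul_sum, Finset.sum_add_distrib, Finset.sum_sub_distrib,
      ← Finset.sum_mul, eu1 hA, eu2 hsym hA, eu3 hsym hA]
    ring
  have h1 : ∑ s, aLow r s * CU a s h k p =
      -((M + 3 : ℝ) * (M + 2) / (2 * Kfun a p)) * (aL3 a aLow p r h k
      - (if r = h then 1 else 0) * aU1 a k p - (if r = k then 1 else 0) * aU1 a h p
      - aL a aLow p r * aU2 a h k p + aL a aLow p r * (2 * aU1 a h p * aU1 a k p)) := by
    have : ∀ s, aLow r s * CU a s h k p =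
      -((M + 3 : ℝ) * (M + 2) / (2 * Kfun a p)) * (aLow r s * aU3 a s h k p
       - aLow r s * aU2 a s h p * aU1 a k p - aLow r s * aU2 a s k p * aU1 a h p
       - aLow r s * aU1 a s p * aU2 a h k p
       + aLow r s * aU1 a s p * (2 * aU1 a h p * aU1 a k p)) := by
      intro s
      rw [CU_eq hsym hA]
      field_simp
    simp only [this, ← Finset.mul_sum, Finset.sum_add_distrib, Finset.sum_sub_distrib,
      ← Finset.sum_mul, low_up hInv₂]
    rfl
  have h2 : CL a aLow p r h k = 1 / (M + 3 : ℝ) * ∑ s, aLow r s * CU a s h k p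
      + (M + 2 : ℝ) / (M + 3) * aL a aLow p r * ∑ s, p s / Kfun a p * CU a s h k p := by
    unfold CL gL
    rw [Finset.mul_sum, Finset.mul_sum, ← Finset.sum_add_distrib]
    refine Finset.sum_congr rfl fun s _ => ?_
    rw [aL_eq hsym hA hInv₂ s]
    ring
  rw [h2, h0, h1, aL_eq hsym hA hInv₂]
  have : (M + 3 : ℝ) ≠ 0 := by positivity
  generalize (if r = h then (1 : ℝ) else 0) = d1
  generalize (if r = k then (1 : ℝ) else 0) = d2
  field_simp
  ring

lemma CC_eq (hsym : aSym a) (hA : 0 < Afun a p)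
    (hInv₁ : (Matrix.of fun i j => aU2 a i j p) * aLow = 1)
    (hInv₂ : aLow * (Matrix.of fun i j => aU2 a i j p) = 1) (i j h k : Fin n) :
    ∑ r, CU a r i j p * CL a aLow p r h k =
      (M + 3 : ℝ) * (M + 2) ^ 2 / (4 * Kfun a p ^ 2) * (
        ∑ r, aL3 a aLow p r h k * aU3 a r i j p
        - (aU3 a h i j p * aU1 a k p + aU3 a k i j p * aU1 a h p
          + aU3 a i h k p * aU1 a j p + aU3 a j h k p * aU1 a i p)
        - aU2 a i j p * aU2 a h k p
        + aU2 a i h p * aU1 a j p * aU1 a k p + aU2 a i k p * aU1 a j p * aU1 a h p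
        + aU2 a j h p * aU1 a i p * aU1 a k p + aU2 a j k p * aU1 a i p * aU1 a h p
        + 2 * aU2 a i j p * aU1 a h p * aU1 a k p + 2 * aU2 a h k p * aU1 a i p * aU1 a j p
        - 4 * aU1 a h p * aU1 a i p * aU1 a j p * aU1 a k p) := by
  have hK := (K_pos hA).ne'
  have z : ∑ r, p r / Kfun a p * CU a r i j p = 0 := by
    have : ∀ s, p s / Kfun a p * CU a s i j p =
      -((M + 3 : ℝ) * (M + 2) / (2 * Kfun a p)) * (p s / Kfun a p * aU3 a s i j p
       - p s / Kfun a p * aU2 a s i p * aU1 a j p - p s / Kfun a p * aU2 a s j p * aU1 a i p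
       - p s / Kfun a p * aU1 a s p * aU2 a i j p
       + p s / Kfun a p * aU1 a s p * (2 * aU1 a i p * aU1 a j p)) := by
      intro s
      rw [CU_eq hsym hA]
      field_simp
    simp only [this, ← Finset.mul_sum, Finset.sum_add_distrib, Finset.sum_sub_distrib,
      ← Finset.sum_mul, eu1 hA, eu2 hsym hA, eu3 hsym hA]
    ring
  have w : ∑ r, CU a r i j p * aL3 a aLow p r h k =
      -((M + 3 : ℝ) * (M + 2) / (2 * Kfun a p)) * (∑ r, aL3 a aLow p r h k * aU3 a r i j p
       - aU3 a i h k p * aU1 a j p - aU3 a j h k p * aU1 a i p - aU2 a h k p * aU2 a i j p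
       + aU2 a h k p * (2 * aU1 a i p * aU1 a j p)) := by
    have : ∀ s, CU a s i j p * aL3 a aLow p s h k =
      -((M + 3 : ℝ) * (M + 2) / (2 * Kfun a p)) * (aL3 a aLow p s h k * aU3 a s i j p
       - aU2 a s i p * aL3 a aLow p s h k * aU1 a j p
       - aU2 a s j p * aL3 a aLow p s h k * aU1 a i p
       - aU1 a s p * aL3 a aLow p s h k * aU2 a i j p
       + aU1 a s p * aL3 a aLow p s h k * (2 * aU1 a i p * aU1 a j p)) := by
      intro s
      rw [CU_eq hsym hA]
      field_simp
    simp only [this, ← Finset.mul_sum, Finset.sum_add_distrib, Finset.sum_sub_distrib,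
      ← Finset.sum_mul, aL3_up1 hsym hA hInv₁, aL3_up2 hsym hInv₁]
  have v : ∑ r, CU a r i j p * CL a aLow p r h k =
      -((M + 2 : ℝ) / (2 * Kfun a p)) * (∑ r, CU a r i j p * aL3 a aLow p r h k
        - CU a h i j p * aU1 a k p - CU a k i j p * aU1 a h p
        + (∑ r, p r / Kfun a p * CU a r i j p) * (2 * aU1 a h p * aU1 a k p - aU2 a h k p)) := by
    have e : ∀ h, CU a h i j p = ∑ r, CU a r i j p * (if r = h then 1 else 0) := by
      intro h; simp
    rw [e h, e k]
    simp only [Finset.sum_mul, ← Finset.sum_add_distrib, ← Finset.sum_sub_distrib, Finset.mul_sum]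
    refine Finset.sum_congr rfl fun r _ => ?_
    rw [CL_eq hsym hA hInv₂]
    ring
  rw [v, z, w, CU_eq hsym hA h i j, CU_eq hsym hA k i j, aU2_symm hsym h i, aU2_symm hsym h j,
    aU2_symm hsym k i, aU2_symm hsym k j]
  field_simp
  ring

lemma CU_symm1 (hsym : aSym a) (hA : 0 < Afun a p) (i j k : Fin n) :
    CU a i j k p = CU a j i k p := by
  rw [CU_eq hsym hA, CU_eq hsym hA, aU3_symm1 hsym i j k, aU2_symm hsym i j]
  ring

lemma CU_symm2 (hsym : aSym a) (hA : 0 < Afun a p) (i j k : Fin n) :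
    CU a i j k p = CU a i k j p := by
  rw [CU_eq hsym hA, CU_eq hsym hA, aU3_symm2 hsym i j k, aU2_symm hsym j k]
  ring

end main

/-- for `m = M + 4 ≥ 4`, the T-tensor
`T^{hijk} = K C^{hij}|^k + a^h C^{ijk} + a^i C^{jkh} + a^j C^{khi} + a^k C^{hij}`
is given by formula (10) of the paper. -/
theorem stmt_15 {n M : ℕ} (hn : 4 ≤ n) (a : (Fin (M + 4) → Fin n) → ℝ)
    (hsym : aSym a) (p : Fin n → ℝ) (hA : 0 < Afun a p)
    (aLow : Matrix (Fin n) (Fin n) ℝ)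
    (hInv₁ : (Matrix.of fun i j => aU2 a i j p) * aLow = 1)
    (hInv₂ : aLow * (Matrix.of fun i j => aU2 a i j p) = 1) :
    ∀ h i j k : Fin n,
      Kfun a p * (pd (CU a h i j) k p +
          ∑ r, (CU a r i j p * CL a aLow p r h k + CU a h r j p * CL a aLow p r i k +
            CU a h i r p * CL a aLow p r j k)) +
        aU1 a h p * CU a i j k p + aU1 a i p * CU a j k h p +
        aU1 a j p * CU a k h i p + aU1 a k p * CU a h i j p =
      -((M + 3 : ℝ) * (M + 2) * (M + 1) / (2 * Kfun a p)) * aU4 a h i j k p +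
        ((M + 3 : ℝ) * (M + 2) ^ 2 / (4 * Kfun a p)) *
          (∑ r, (aL3 a aLow p r h k * aU3 a r i j p +
            aL3 a aLow p r i k * aU3 a r h j p +
            aL3 a aLow p r j k * aU3 a r h i p)) -
        ((M + 4 : ℝ) * (M + 3) * (M + 2) / (4 * Kfun a p)) *
          (aU3 a h i j p * aU1 a k p + aU3 a h j k p * aU1 a i p +
            aU3 a i j k p * aU1 a h p + aU3 a h i k p * aU1 a j p -
            aU2 a i j p * aU2 a h k p - aU2 a h j p * aU2 a i k p -
            aU2 a i h p * aU2 a j k p) := by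
  intro h i j k
  have hK := (K_pos hA).ne'
  have e1 : ∀ r, CU a h r j p = CU a r h j p := fun r => CU_symm1 hsym hA _ _ _
  have e2 : ∀ r, CU a h i r p = CU a r h i p := fun r => by
    rw [CU_symm2 hsym hA, CU_symm1 hsym hA]
  have f1 : CU a j k h p = CU a h j k p := by
    rw [CU_symm2 hsym hA, CU_symm1 hsym hA]
  have f2 : CU a k h i p = CU a h i k p := by
    rw [CU_symm1 hsym hA, CU_symm2 hsym hA]
  simp only [Finset.sum_add_distrib]
  have e1' : ∑ r, CU a h r j p * CL a aLow p r i k = ∑ r, CU a r h j p * CL a aLow p r i k :=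
    Finset.sum_congr rfl fun r _ => by rw [e1 r]
  have e2' : ∑ r, CU a h i r p * CL a aLow p r j k = ∑ r, CU a r h i p * CL a aLow p r j k :=
    Finset.sum_congr rfl fun r _ => by rw [e2 r]
  rw [e1', e2', CC_eq hsym hA hInv₁ hInv₂, CC_eq hsym hA hInv₁ hInv₂, CC_eq hsym hA hInv₁ hInv₂,
    pd_CU hsym hA, f1, f2, CU_eq hsym hA i j k, CU_eq hsym hA h j k, CU_eq hsym hA h i k,
    CU_eq hsym hA h i j]
  have s3 : ∀ x y z, aU3 a x y z p = aU3 a y x z p := fun x y z => aU3_symm1 hsym x y z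
  have s4 : ∀ x y z, aU3 a x y z p = aU3 a x z y p := fun x y z => aU3_symm2 hsym x y z
  rw [show aU3 a k i j p = aU3 a i j k p by rw [s3 k i j, s4 i k j],
    show aU3 a k h j p = aU3 a h j k p by rw [s3 k h j, s4 h k j],
    show aU3 a k h i p = aU3 a h i k p by rw [s3 k h i, s4 h k i],
    show aU3 a j h k p = aU3 a h j k p from s3 _ _ _,
    show aU3 a i h k p = aU3 a h i k p from s3 _ _ _,
    show aU3 a j i k p = aU3 a i j k p from s3 _ _ _,
    show aU3 a i h j p = aU3 a h i j p from s3 _ _ _,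
    show aU3 a j h i p = aU3 a h i j p by rw [s3 j h i, s4 h j i],
    aU2_symm hsym i h, aU2_symm hsym j h, aU2_symm hsym j i]
  field_simp
  ring
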